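/- arXiv:gr-qc/0204030 — 7 statements merged into one kernel-verified Lean document; each statement's English description precedes it below -/
import Mathlib

section
/- Sandwich lemma for ODEs at a singular endpoint: Let r₀ > 0 and let f : (0,r₀]×ℝ → ℝ be continuous and locally Lipschitz in its second variable. Let w, v : (0,r₀] → ℝ be C¹ functions with w(r) < v(r) for all r ∈ (0,r₀], such that w is a supersolution (w′(r) ≥ f(r,w(r)) for all r) and v is a subsolution (v′(r) ≤ f(r,v(r)) for all r), and such that lim_{r→0⁺} w(r) = lim_{r→0⁺} v(r) = 0. Then for every y₀ ∈ (w(r₀), v(r₀)) there is a solution y of y′ = f(r,y) defined on all of (0,r₀] with y(r₀) = y₀, w(r) ≤ y(r) ≤ v(r) for all r ∈ (0,r₀], and lim_{r→0⁺} y(r) = 0. -/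
noncomputable section

open Real Set Filter Topology

/-- A function continuous on `s × ℝ` and locally Lipschitz in its second variable is Lipschitz in
that variable uniformly on `t × u` for compact `t ⊆ s` and `u`. -/
lemma exists_uniform_lipschitz_snd_of_isCompact {f : ℝ → ℝ → ℝ} {s t u : Set ℝ}
    (hf_cont : ContinuousOn (fun p : ℝ × ℝ => f p.1 p.2) (s ×ˢ (univ : Set ℝ)))
    (hf_lip : ∀ r ∈ s, ∀ y : ℝ, ∃ K : ℝ, ∃ ε > (0:ℝ),
      ∀ r' ∈ s, |r' - r| < ε → ∀ y₁ y₂ : ℝ, |y₁ - y| < ε → |y₂ - y| < ε →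
        |f r' y₁ - f r' y₂| ≤ K * |y₁ - y₂|)
    (ht : IsCompact t) (hts : t ⊆ s) (hu : IsCompact u) :
    ∃ K : ℝ, ∀ r ∈ t, ∀ y₁ ∈ u, ∀ y₂ ∈ u, |f r y₁ - f r y₂| ≤ K * |y₁ - y₂| := by
  suffices H : ∃ K : ℝ, ∀ p ∈ t ×ˢ u ×ˢ u,
      |f p.1 p.2.1 - f p.1 p.2.2| ≤ K * |p.2.1 - p.2.2| by
    obtain ⟨K, hK⟩ := H
    exact ⟨K, fun r hr y₁ h₁ y₂ h₂ => hK (r, y₁, y₂) ⟨hr, h₁, h₂⟩⟩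
  refine (ht.prod (hu.prod hu)).induction_on
    (p := fun S => ∃ K : ℝ, ∀ p ∈ S, |f p.1 p.2.1 - f p.1 p.2.2| ≤ K * |p.2.1 - p.2.2|)
    ⟨0, by simp⟩ (fun S T hST ⟨K, hK⟩ => ⟨K, fun p hp => hK p (hST hp)⟩) ?_ ?_
  · rintro S T ⟨K, hK⟩ ⟨K', hK'⟩
    refine ⟨max K K', ?_⟩
    rintro p (hp | hp)
    · exact (hK p hp).trans (by gcongr; exact le_max_left _ _)
    · exact (hK' p hp).trans (by gcongr; exact le_max_right _ _)
  · rintro ⟨r, y₁, y₂⟩ hp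
    have hr : r ∈ t := hp.1
    by_cases hy : y₁ = y₂
    · subst hy
      obtain ⟨K, ε, hε, hK⟩ := hf_lip r (hts hr) y₁
      refine ⟨(t ×ˢ u ×ˢ u) ∩ Metric.ball (r, y₁, y₁) ε,
        inter_mem self_mem_nhdsWithin (mem_nhdsWithin_of_mem_nhds (Metric.ball_mem_nhds _ hε)),
        K, ?_⟩
      rintro ⟨r', z₁, z₂⟩ ⟨⟨hr', -⟩, hb⟩
      simp only [Metric.mem_ball, Prod.dist_eq, max_lt_iff, Real.dist_eq] at hb
      exact hK r' (hts hr') hb.1 z₁ z₂ hb.2.1 hb.2.2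
    · have h₁ : ContinuousOn (fun p : ℝ × ℝ × ℝ => f p.1 p.2.1) (t ×ˢ u ×ˢ u) :=
        hf_cont.comp (f := fun p : ℝ × ℝ × ℝ => (p.1, p.2.1)) (by fun_prop)
          fun p hp => ⟨hts hp.1, mem_univ _⟩
      have h₂ : ContinuousOn (fun p : ℝ × ℝ × ℝ => f p.1 p.2.2) (t ×ˢ u ×ˢ u) :=
        hf_cont.comp (f := fun p : ℝ × ℝ × ℝ => (p.1, p.2.2)) (by fun_prop)
          fun p hp => ⟨hts hp.1, mem_univ _⟩
      have hne : |y₁ - y₂| ≠ 0 := abs_ne_zero.2 (sub_ne_zero.2 hy)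
      have hden : Continuous fun p : ℝ × ℝ × ℝ => |p.2.1 - p.2.2| := by fun_prop
      have hq := ((h₁.sub h₂).abs (r, y₁, y₂) hp).div
        hden.continuousWithinAt hne
      have hlt := hq.eventually_lt_const (lt_add_one _)
      have hpos := hden.continuousWithinAt (s := t ×ˢ u ×ˢ u) (x := (r, y₁, y₂))
        |>.eventually_const_lt (abs_pos.2 (sub_ne_zero.2 hy))
      exact ⟨_, hlt.and hpos, _, fun p hp => ((div_lt_iff₀ hp.2).1 hp.1).le⟩

/-- A function whose derivative is nonpositive wherever the function is negative stays negative
once it is negative. -/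
lemma neg_of_neg_of_deriv_nonpos {h h' : ℝ → ℝ} {a b : ℝ} (hab : a ≤ b)
    (hd : ∀ x ∈ Icc a b, HasDerivAt h (h' x) x)
    (hle : ∀ x ∈ Icc a b, h x < 0 → h' x ≤ 0) (ha : h a < 0) : h b < 0 := by
  set ε := -h a / (2 * (b - a + 1)) with hε_def
  have hba : 0 < b - a + 1 := by linarith
  have hε : 0 < ε := div_pos (by linarith) (by linarith)
  have hεb : ε * (b - a + 1) = -h a / 2 := by rw [hε_def]; field_simp
  have hneg : ∀ x ∈ Icc a b, h a + ε * (x - a) < 0 := fun x hx => by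
    nlinarith [mul_le_mul_of_nonneg_left hx.2 hε.le]
  refine lt_of_le_of_lt (image_le_of_deriv_right_lt_deriv_boundary (f := h) (f' := h')
    (B := fun x => h a + ε * (x - a)) (B' := fun _ => ε)
    (fun x hx => (hd x hx).continuousAt.continuousWithinAt)
    (fun x hx => (hd x (Ico_subset_Icc_self hx)).hasDerivWithinAt) (by simp) (fun x => ?_)
    (fun x hx hxB => ?_) (right_mem_Icc.2 hab)) (hneg b (right_mem_Icc.2 hab))
  · simpa using (((hasDerivAt_id x).sub_const a).const_mul ε).const_add (h a)
  · have hx := Ico_subset_Icc_self hx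
    exact (hle x hx (hxB ▸ hneg x hx)).trans_lt hε

/-- A vector field on `(c, b)` which, on every `[a, b]` with `c < a`, is bounded, continuous in time
and uniformly Lipschitz in space has a solution on all of `(c, b)`. -/
lemma exists_hasDerivAt_Ioo_of_lipschitz_bounded {E : Type*} [NormedAddCommGroup E]
    [NormedSpace ℝ E] [CompleteSpace E] {g : ℝ → E → E} {c b t₀ : ℝ} (ht₀ : t₀ ∈ Ioo c b)
    (hcont : ∀ x, ContinuousOn (g · x) (Ioc c b))
    (hlip : ∀ a ∈ Ioo c b, ∃ K, ∀ t ∈ Icc a b, LipschitzWith K (g t))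
    (hbdd : ∀ a ∈ Ioo c b, ∃ L, ∀ t ∈ Icc a b, ∀ x, ‖g t x‖ ≤ L) (x₀ : E) :
    ∃ y : ℝ → E, y t₀ = x₀ ∧ ∀ t ∈ Ioo c b, HasDerivAt y (g t (y t)) t := by
  have hsol : ∀ a ∈ Ioo c t₀, ∃ y : ℝ → E, y t₀ = x₀ ∧
      ∀ t ∈ Icc a b, HasDerivWithinAt y (g t (y t)) (Icc a b) t := by
    intro a ha
    have hab : a ∈ Ioo c b := ⟨ha.1, ha.2.trans ht₀.2⟩
    obtain ⟨K, hK⟩ := hlip a hab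
    obtain ⟨L, hL⟩ := hbdd a hab
    have hPL : IsPicardLindelof g (tmin := a) (tmax := b) ⟨t₀, ha.2.le, ht₀.2.le⟩ x₀
        (L.toNNReal * (max (b - t₀) (t₀ - a)).toNNReal) 0 L.toNNReal K :=
      { lipschitzOnWith := fun t ht => (hK t ht).lipschitzOnWith
        continuousOn := fun x _ => (hcont x).mono fun t ht => ⟨ha.1.trans_le ht.1, ht.2⟩
        norm_le := fun t ht x _ => (hL t ht x).trans (Real.le_coe_toNNReal L)
        mul_max_le := by
          have : 0 ≤ max (b - t₀) (t₀ - a) := le_max_of_le_left (by linarith [ht₀.2])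
          simp [Real.coe_toNNReal _ this] }
    exact hPL.exists_eq_forall_mem_Icc_hasDerivWithinAt₀
  choose! Y hY₀ hY using hsol
  have huniq : ∀ a ∈ Ioo c t₀, ∀ a' ∈ Ioo c t₀, a ≤ a' → EqOn (Y a) (Y a') (Icc a' b) := by
    intro a ha a' ha' haa'
    obtain ⟨K, hK⟩ := hlip a' ⟨ha'.1, ha'.2.trans ht₀.2⟩
    refine ODE_solution_unique_of_mem_Icc (v := g) (s := fun _ => univ) (t₀ := t₀) (K := K)
      (fun t ht => (hK t (Ioo_subset_Icc_self ht)).lipschitzOnWith) ⟨ha'.2, ht₀.2⟩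
      (fun t ht => ((hY a ha t ⟨haa'.trans ht.1, ht.2⟩).mono
        (Icc_subset_Icc_left haa')).continuousWithinAt)
      (fun t ht => (hY a ha t ⟨haa'.trans ht.1.le, ht.2.le⟩).hasDerivAt
        (Icc_mem_nhds (haa'.trans_lt ht.1) ht.2)) (fun _ _ => mem_univ _)
      (fun t ht => (hY a' ha' t ht).continuousWithinAt)
      (fun t ht => (hY a' ha' t (Ioo_subset_Icc_self ht)).hasDerivAt
        (Icc_mem_nhds ht.1 ht.2)) (fun _ _ => mem_univ _) ?_
    rw [hY₀ a ha, hY₀ a' ha']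
  set α : ℝ → ℝ := fun t => (c + min t t₀) / 2 with hα
  have hαmem : ∀ t, c < t → α t ∈ Ioo c t₀ ∧ α t < t := fun t ht => by
    have h₁ := lt_min ht ht₀.1
    have h₂ := min_le_left t t₀
    have h₃ := min_le_right t t₀
    refine ⟨⟨?_, ?_⟩, ?_⟩ <;> simp only [hα] <;> linarith
  refine ⟨fun t => Y (α t) t, hY₀ _ (hαmem t₀ ht₀.1).1, fun t ht => ?_⟩
  obtain ⟨hmem, hlt⟩ := hαmem t ht.1
  have heq : ∀ s ∈ Ioo (α t) b, Y (α s) s = Y (α t) s := fun s hs => by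
    obtain ⟨hmem', hlt'⟩ := hαmem s (hmem.1.trans hs.1)
    rcases le_total (α s) (α t) with h | h
    · exact huniq _ hmem' _ hmem h ⟨hs.1.le, hs.2.le⟩
    · exact (huniq _ hmem _ hmem' h ⟨hlt'.le, hs.2.le⟩).symm
  exact ((hY _ hmem t ⟨hlt.le, ht.2.le⟩).hasDerivAt (Icc_mem_nhds hlt ht.2)).congr_of_eventuallyEq
    (eventually_of_mem (Ioo_mem_nhds hlt ht.2) heq)

/-- **Sandwich lemma for ODEs at a singular endpoint.** Let `f : (0,r₀] × ℝ → ℝ` be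
continuous and locally Lipschitz in its second variable. Let `w < v` be `C¹` functions
on `(0,r₀]`, respectively a supersolution (`w′ ≥ f(r,w)`) and a subsolution
(`v′ ≤ f(r,v)`) of `y′ = f(r,y)`, both tending to `0` as `r → 0⁺`. Then for every
`y₀ ∈ (w(r₀), v(r₀))` there is a solution `y` of `y′ = f(r,y)` on all of `(0,r₀]` with
`y(r₀) = y₀`, squeezed between `w` and `v`, and tending to `0` as `r → 0⁺`. -/
theorem sandwich_ode_solution_at_singular_endpoint
    (r₀ : ℝ) (hr₀ : 0 < r₀) (f : ℝ → ℝ → ℝ)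
    (hf_cont : ContinuousOn (fun p : ℝ × ℝ => f p.1 p.2) (Ioc 0 r₀ ×ˢ (univ : Set ℝ)))
    (hf_lip : ∀ r ∈ Ioc (0:ℝ) r₀, ∀ y : ℝ, ∃ K : ℝ, ∃ ε > (0:ℝ),
      ∀ r' ∈ Ioc (0:ℝ) r₀, |r' - r| < ε →
        ∀ y₁ y₂ : ℝ, |y₁ - y| < ε → |y₂ - y| < ε →
          |f r' y₁ - f r' y₂| ≤ K * |y₁ - y₂|)
    (w v w' v' : ℝ → ℝ)
    (hw_deriv : ∀ r ∈ Ioc (0:ℝ) r₀, HasDerivAt w (w' r) r)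
    (hw'_cont : ContinuousOn w' (Ioc 0 r₀))
    (hv_deriv : ∀ r ∈ Ioc (0:ℝ) r₀, HasDerivAt v (v' r) r)
    (hv'_cont : ContinuousOn v' (Ioc 0 r₀))
    (hwv : ∀ r ∈ Ioc (0:ℝ) r₀, w r < v r)
    (hsuper : ∀ r ∈ Ioc (0:ℝ) r₀, f r (w r) ≤ w' r)
    (hsub : ∀ r ∈ Ioc (0:ℝ) r₀, v' r ≤ f r (v r))
    (hw0 : Tendsto w (𝓝[>] 0) (𝓝 0)) (hv0 : Tendsto v (𝓝[>] 0) (𝓝 0)) :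
    ∀ y₀ ∈ Ioo (w r₀) (v r₀), ∃ y : ℝ → ℝ,
      y r₀ = y₀ ∧
      (∀ r ∈ Ioc (0:ℝ) r₀, HasDerivAt y (f r (y r)) r) ∧
      (∀ r ∈ Ioc (0:ℝ) r₀, w r ≤ y r ∧ y r ≤ v r) ∧
      Tendsto y (𝓝[>] 0) (𝓝 0) := by
  intro y₀ hy₀
  have hw_cont : ContinuousOn w (Ioc 0 r₀) :=
    fun r hr => (hw_deriv r hr).continuousAt.continuousWithinAt
  have hv_cont : ContinuousOn v (Ioc 0 r₀) :=
    fun r hr => (hv_deriv r hr).continuousAt.continuousWithinAt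
  set g : ℝ → ℝ → ℝ := fun r x =>
    f (min r r₀) (max (w (min r r₀)) (min x (v (min r r₀)))) with hg
  have hmin : MapsTo (fun r => min r r₀) (Ioc 0 (r₀ + 1)) (Ioc 0 r₀) :=
    fun r hr => ⟨lt_min hr.1 hr₀, min_le_right _ _⟩
  have hmin_cont : ContinuousOn (fun r => min r r₀) (Ioc 0 (r₀ + 1)) := by fun_prop
  have hbox : ∀ a ∈ Ioo 0 (r₀ + 1), ∃ m M : ℝ, ∀ t ∈ Icc a (r₀ + 1),
      min t r₀ ∈ Icc (min a r₀) r₀ ∧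
      ∀ x, max (w (min t r₀)) (min x (v (min t r₀))) ∈ Icc m M := by
    intro a ha
    have hsub' : Icc (min a r₀) r₀ ⊆ Ioc 0 r₀ := fun r hr => ⟨(lt_min ha.1 hr₀).trans_le hr.1, hr.2⟩
    obtain ⟨m, hm⟩ := (isCompact_Icc.image_of_continuousOn (hw_cont.mono hsub')).bddBelow
    obtain ⟨M, hM⟩ := (isCompact_Icc.image_of_continuousOn (hv_cont.mono hsub')).bddAbove
    refine ⟨m, M, fun t ht => ?_⟩
    have ht' : min t r₀ ∈ Icc (min a r₀) r₀ := ⟨min_le_min_right _ ht.1, min_le_right _ _⟩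
    have hM' := hM (mem_image_of_mem v ht')
    exact ⟨ht', fun x => ⟨(hm (mem_image_of_mem w ht')).trans (le_max_left _ _),
      max_le ((hwv _ (hsub' ht')).le.trans hM') ((min_le_right _ _).trans hM')⟩⟩
  have hg_cont : ∀ x, ContinuousOn (g · x) (Ioc 0 (r₀ + 1)) := fun x => by
    have hw_min : ContinuousOn (fun r => w (min r r₀)) (Ioc 0 (r₀ + 1)) :=
      hw_cont.comp hmin_cont hmin
    have hv_min : ContinuousOn (fun r => v (min r r₀)) (Ioc 0 (r₀ + 1)) :=
      hv_cont.comp hmin_cont hmin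
    exact hf_cont.comp (hmin_cont.prodMk (hw_min.sup (continuousOn_const.inf hv_min)))
      fun r hr => ⟨hmin hr, mem_univ _⟩
  have hg_lip : ∀ a ∈ Ioo 0 (r₀ + 1), ∃ K, ∀ t ∈ Icc a (r₀ + 1), LipschitzWith K (g t) := by
    intro a ha
    obtain ⟨m, M, hmM⟩ := hbox a ha
    obtain ⟨K, hK⟩ := exists_uniform_lipschitz_snd_of_isCompact hf_cont hf_lip
      (isCompact_Icc (a := min a r₀) (b := r₀))
      (fun r hr => ⟨(lt_min ha.1 hr₀).trans_le hr.1, hr.2⟩) (isCompact_Icc (a := m) (b := M))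
    refine ⟨K.toNNReal, fun t ht => LipschitzWith.of_dist_le_mul fun x z => ?_⟩
    obtain ⟨ht', hmem⟩ := hmM t ht
    rw [Real.dist_eq, Real.dist_eq]
    refine (hK _ ht' _ (hmem x) _ (hmem z)).trans ?_
    refine mul_le_mul (Real.le_coe_toNNReal K) ?_ (abs_nonneg _) (NNReal.coe_nonneg _)
    rw [max_comm (w _), max_comm (w _)]
    refine (abs_max_sub_max_le_abs _ _ _).trans ?_
    simpa using abs_min_sub_min_le_max x (v (min t r₀)) z (v (min t r₀))
  have hg_bdd : ∀ a ∈ Ioo 0 (r₀ + 1), ∃ L, ∀ t ∈ Icc a (r₀ + 1), ∀ x, ‖g t x‖ ≤ L := by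
    intro a ha
    obtain ⟨m, M, hmM⟩ := hbox a ha
    obtain ⟨L, hL⟩ := ((isCompact_Icc (a := min a r₀) (b := r₀)).prod
      (isCompact_Icc (a := m) (b := M))).exists_bound_of_continuousOn
      (hf_cont.mono fun p hp => ⟨⟨(lt_min ha.1 hr₀).trans_le hp.1.1, hp.1.2⟩, mem_univ _⟩)
    exact ⟨L, fun t ht x => hL (_, _) ⟨(hmM t ht).1, (hmM t ht).2 x⟩⟩
  obtain ⟨y, hyr₀, hy⟩ := exists_hasDerivAt_Ioo_of_lipschitz_bounded
    ⟨hr₀, lt_add_one r₀⟩ hg_cont hg_lip hg_bdd y₀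
  have hsand : ∀ r ∈ Ioc (0:ℝ) r₀, w r ≤ y r ∧ y r ≤ v r := by
    intro r hr
    have hd : ∀ x ∈ Icc r r₀, x ∈ Ioc 0 r₀ ∧
        HasDerivAt y (f x (max (w x) (min (y x) (v x)))) x := fun x hx => by
      have := hy x ⟨hr.1.trans_le hx.1, hx.2.trans_lt (lt_add_one _)⟩
      simp only [hg, min_eq_left hx.2] at this
      exact ⟨⟨hr.1.trans_le hx.1, hx.2⟩, this⟩
    constructor
    · by_contra! hlt
      have := neg_of_neg_of_deriv_nonpos (h := fun x => y x - w x) hr.2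
        (fun x hx => (hd x hx).2.sub (hw_deriv x (hd x hx).1)) (fun x hx hneg => ?_)
        (by simpa using hlt)
      · simp only [hyr₀] at this
        linarith [hy₀.1]
      · have hx' := (hd x hx).1
        rw [max_eq_left ((min_le_left _ _).trans (by linarith))]
        linarith [hsuper x hx']
    · by_contra! hlt
      have := neg_of_neg_of_deriv_nonpos (h := fun x => v x - y x) hr.2
        (fun x hx => (hv_deriv x (hd x hx).1).sub (hd x hx).2) (fun x hx hneg => ?_)
        (by simpa using hlt)
      · simp only [hyr₀] at this
        linarith [hy₀.2]
      · have hx' := (hd x hx).1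
        rw [min_eq_right (by linarith), max_eq_right (hwv x hx').le]
        linarith [hsub x hx']
  refine ⟨y, hyr₀, fun r hr => ?_, hsand, ?_⟩
  · have := hy r ⟨hr.1, hr.2.trans_lt (lt_add_one _)⟩
    simpa only [hg, min_eq_left hr.2, min_eq_left (hsand r hr).2, max_eq_right (hsand r hr).1]
      using this
  · have hev : ∀ᶠ r in 𝓝[>] (0:ℝ), r ∈ Ioc 0 r₀ := Ioc_mem_nhdsGT hr₀
    exact tendsto_of_tendsto_of_tendsto_of_le_of_le' hw0 hv0
      (hev.mono fun r hr => (hsand r hr).1) (hev.mono fun r hr => (hsand r hr).2)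
end
end

section
/- Blow-up comparison lemma: Let r₀ > 0, let φ : (0,r₀] → ℝ be continuous and bounded, and let ψ : [0,r₀] → ℝ be continuous with ψ(0) = 1 and ∫₀^{r₀} |ψ(s) − 1|/s ds < ∞. Suppose x : (0,r₀] → ℝ is C¹ and satisfies x′(r) = −(2ψ(r)/r) x(r) + φ(r) for all r ∈ (0,r₀], and that x(r) → +∞ as r → 0⁺. Then there exist λ > 0 and r₁ ∈ (0,r₀] such that x(r) ≥ λ/r² for all r ∈ (0,r₁]. -/
noncomputable section

open Real Set Filter Topology MeasureTheory

/-- A primitive based at `0` of a function integrable and continuous on `(0,b]` is bounded there by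
the integral of the absolute value, and differentiable on `(0,b)`. -/
theorem primitive_bound_and_hasDerivAt {g : ℝ → ℝ} {b : ℝ}
    (hg : ContinuousOn g (Ioc 0 b)) (hi : IntegrableOn g (Ioc 0 b)) :
    (∀ r ∈ Ioc (0:ℝ) b, |∫ s in (0:ℝ)..r, g s| ≤ ∫ s in Ioc (0:ℝ) b, |g s|) ∧
    ∀ r ∈ Ioo (0:ℝ) b, HasDerivAt (fun u => ∫ s in (0:ℝ)..u, g s) (g r) r := by
  constructor
  · intro r hr
    rw [intervalIntegral.integral_of_le hr.1.le]
    calc |∫ s in Ioc 0 r, g s| ≤ ∫ s in Ioc 0 r, |g s| := abs_integral_le_integral_abs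
      _ ≤ _ := setIntegral_mono_set hi.abs (Eventually.of_forall fun s => abs_nonneg _)
        (Ioc_subset_Ioc_right hr.2).eventuallyLE
  · intro r hr
    have hgo : ContinuousOn g (Ioo 0 b) := hg.mono Ioo_subset_Ioc_self
    refine intervalIntegral.integral_hasDerivAt_right ?_
      (hgo.stronglyMeasurableAtFilter isOpen_Ioo r hr) (hgo.continuousAt (isOpen_Ioo.mem_nhds hr))
    rw [intervalIntegrable_iff_integrableOn_Ioc_of_le hr.1.le]
    exact hi.mono_set (Ioc_subset_Ioc_right hr.2.le)

/-- **Blow-up comparison lemma.** Let `φ` be continuous and bounded on `(0,r₀]`, and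
`ψ` continuous on `[0,r₀]` with `ψ(0) = 1` and `∫₀^{r₀} |ψ(s) − 1|/s ds < ∞`. If
`x : (0,r₀] → ℝ` is `C¹`, satisfies `x′(r) = −(2ψ(r)/r) x(r) + φ(r)`, and `x(r) → +∞`
as `r → 0⁺`, then `x(r) ≥ λ/r²` near `0` for some `λ > 0`. -/
theorem blowup_comparison
    (r₀ : ℝ) (hr₀ : 0 < r₀) (φ ψ x : ℝ → ℝ)
    (hφ_cont : ContinuousOn φ (Ioc 0 r₀))
    (hφ_bdd : ∃ M : ℝ, ∀ r ∈ Ioc (0:ℝ) r₀, |φ r| ≤ M)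
    (hψ_cont : ContinuousOn ψ (Icc 0 r₀))
    (hψ0 : ψ 0 = 1)
    (hψ_int : IntegrableOn (fun s => |ψ s - 1| / s) (Ioc 0 r₀))
    (hx : ∀ r ∈ Ioc (0:ℝ) r₀, HasDerivAt x (-(2 * ψ r / r) * x r + φ r) r)
    (hblow : Tendsto x (𝓝[>] 0) atTop) :
    ∃ lam > (0:ℝ), ∃ r₁ ∈ Ioc (0:ℝ) r₀, ∀ r ∈ Ioc (0:ℝ) r₁, lam / r ^ 2 ≤ x r := by
  obtain ⟨M, hM⟩ := hφ_bdd
  have hM0 : 0 ≤ M := (abs_nonneg _).trans (hM r₀ ⟨hr₀, le_rfl⟩)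
  have hg_cont : ContinuousOn (fun s => (ψ s - 1) / s) (Ioc 0 r₀) :=
    ((hψ_cont.mono Ioc_subset_Icc_self).sub continuousOn_const).div continuousOn_id
      fun s hs => hs.1.ne'
  have hg_int : IntegrableOn (fun s => (ψ s - 1) / s) (Ioc 0 r₀) := by
    refine Integrable.mono hψ_int (hg_cont.aestronglyMeasurable measurableSet_Ioc) ?_
    exact Eventually.of_forall fun s => by simp
  obtain ⟨hG_bdd, hG_deriv⟩ := primitive_bound_and_hasDerivAt hg_cont hg_int
  set A := ∫ s in Ioc (0:ℝ) r₀, |(ψ s - 1) / s|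
  set G : ℝ → ℝ := fun u => ∫ s in (0:ℝ)..u, (ψ s - 1) / s
  have hE_le : ∀ r ∈ Ioc (0:ℝ) r₀, exp (2 * G r) ≤ exp (2 * A) := fun r hr =>
    exp_le_exp.2 (by have := (abs_le.1 (hG_bdd r hr)).2; linarith)
  have hle_E : ∀ r ∈ Ioc (0:ℝ) r₀, exp (-(2 * A)) ≤ exp (2 * G r) := fun r hr =>
    exp_le_exp.2 (by have := (abs_le.1 (hG_bdd r hr)).1; linarith)
  set C := exp (2 * A) * M
  have hC0 : 0 ≤ C := by positivity
  obtain ⟨r₁, hr₁x, hr₁⟩ : ∃ r₁, exp (2 * A) * (C * r₀ + 1) ≤ x r₁ ∧ r₁ ∈ Ioo 0 r₀ :=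
    ((hblow.eventually_ge_atTop _).and (Ioo_mem_nhdsGT hr₀)).exists
  have hsub : Ioc 0 r₁ ⊆ Ioo 0 r₀ := fun r hr => ⟨hr.1, hr.2.trans_lt hr₁.2⟩
  set z : ℝ → ℝ := fun r => r ^ 2 * exp (2 * G r) * x r - C * r ^ 3 with hz
  have hz_deriv : ∀ r ∈ Ioo 0 r₀,
      HasDerivAt z (r ^ 2 * (exp (2 * G r) * φ r - 3 * C)) r := by
    intro r hr
    have hr0 : r ≠ 0 := hr.1.ne'
    have h := (((hasDerivAt_pow 2 r).mul ((hG_deriv r hr).const_mul 2).exp).mul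
      (hx r (Ioo_subset_Ioc_self hr))).sub ((hasDerivAt_pow 3 r).const_mul C)
    refine h.congr_deriv ?_
    simp only [Pi.mul_apply]
    field_simp
    push_cast
    ring
  have hz_anti : AntitoneOn z (Ioc 0 r₁) := by
    refine antitoneOn_of_deriv_nonpos (convex_Ioc 0 r₁)
      (fun r hr => (hz_deriv r (hsub hr)).continuousAt.continuousWithinAt)
      (fun r hr => (hz_deriv r (hsub (interior_subset hr))).differentiableAt.differentiableWithinAt)
      fun r hr => ?_
    have hr' := hsub (interior_subset hr)
    rw [(hz_deriv r hr').deriv]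
    refine mul_nonpos_of_nonneg_of_nonpos (sq_nonneg r) ?_
    have h : exp (2 * G r) * φ r ≤ C :=
      calc exp (2 * G r) * φ r ≤ exp (2 * G r) * M := by
            gcongr
            exact (abs_le.1 (hM r (Ioo_subset_Ioc_self hr'))).2
        _ ≤ C := mul_le_mul_of_nonneg_right (hE_le r (Ioo_subset_Ioc_self hr')) hM0
    linarith
  have hz_pos : 0 < z r₁ := by
    have h1 : C * r₀ + 1 ≤ exp (2 * G r₁) * x r₁ :=
      calc C * r₀ + 1 = exp (-(2 * A)) * (exp (2 * A) * (C * r₀ + 1)) := by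
            rw [← mul_assoc, ← exp_add]; simp
        _ ≤ exp (2 * G r₁) * x r₁ := by
            have := hle_E r₁ (Ioo_subset_Ioc_self hr₁)
            have := hr₀.le
            gcongr
    have h2 : C * r₁ ≤ C * r₀ := by gcongr; exact hr₁.2.le
    have h3 : z r₁ = r₁ ^ 2 * (exp (2 * G r₁) * x r₁ - C * r₁) := by simp only [hz]; ring
    rw [h3]
    exact mul_pos (pow_pos hr₁.1 2) (by linarith)
  refine ⟨z r₁ / exp (2 * A), by positivity, r₁, Ioo_subset_Ioc_self hr₁, fun r hr => ?_⟩
  have hr0 : 0 < r := hr.1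
  have h1 : z r₁ ≤ r ^ 2 * exp (2 * G r) * x r := by
    have h := hz_anti hr ⟨hr₁.1, le_rfl⟩ hr.2
    have : 0 ≤ C * r ^ 3 := by positivity
    simp only [hz] at h ⊢
    linarith
  have hx_pos : 0 < x r := pos_of_mul_pos_right (hz_pos.trans_le h1) (by positivity)
  rw [div_div, div_le_iff₀ (by positivity)]
  calc z r₁ ≤ r ^ 2 * exp (2 * G r) * x r := h1
    _ ≤ r ^ 2 * exp (2 * A) * x r := by
        have := hE_le r (Ioo_subset_Ioc_self (hsub hr))
        gcongr ?_ ^ 2 * ?_ * ?_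
    _ = x r * (exp (2 * A) * r ^ 2) := by ring
end
end

section
/- Critical-point sequence lemma: Let r₀ > 0 and let x : (0,r₀] → ℝ be a bounded C¹ function such that the limit of x(r) as r → 0⁺ does not exist (i.e. liminf_{r→0⁺} x(r) < limsup_{r→0⁺} x(r)). Then there exists a strictly decreasing sequence (r_m) with r_m → 0, x′(r_m) = 0 for every m, and such that the sequence (x(r_m)) converges. -/
noncomputable section

open Real Set Filter Topology

/-- A bounded differentiable function on `(a, b)` without critical points has a right limit
at `a`. -/
theorem exists_tendsto_nhdsGT_of_deriv_ne_zero {f : ℝ → ℝ} {a b M : ℝ} (hab : a < b)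
    (hdiff : ∀ r ∈ Ioo a b, DifferentiableAt ℝ f r) (hne : ∀ r ∈ Ioo a b, deriv f r ≠ 0)
    (hM : ∀ r ∈ Ioo a b, |f r| ≤ M) : ∃ L, Tendsto f (𝓝[>] a) (𝓝 L) := by
  have hcont : ContinuousOn f (Ioo a b) :=
    fun r hr => (hdiff r hr).continuousAt.continuousWithinAt
  have hlt : ∀ s ∈ Ioo a b, ∀ t ∈ Ioo a b, s < t → f s ≠ f t := by
    intro s hs t ht hst heq
    obtain ⟨c, hc, hc0⟩ := exists_deriv_eq_zero hst
      (hcont.mono (Icc_subset_Ioo hs.1 ht.2)) heq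
    exact hne c ⟨hs.1.trans hc.1, hc.2.trans ht.2⟩ hc0
  have hinj : InjOn f (Ioo a b) := by
    intro s hs t ht heq
    rcases lt_trichotomy s t with h | h | h
    · exact absurd heq (hlt s hs t ht h)
    · exact h
    · exact absurd heq.symm (hlt t ht s hs h)
  have hnonempty : (Ioo a b).Nonempty := nonempty_Ioo.mpr hab
  rcases hcont.strictMonoOn_of_injOn_Ioo hab hinj with h | h
  · exact ⟨_, h.monotoneOn.tendsto_nhdsWithin_Ioo_right hnonempty
      ⟨-M, forall_mem_image.mpr fun r hr => (abs_le.mp (hM r hr)).1⟩⟩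
  · exact ⟨_, h.antitoneOn.tendsto_nhdsWithin_Ioo_right hnonempty
      ⟨M, forall_mem_image.mpr fun r hr => (abs_le.mp (hM r hr)).2⟩⟩

/-- **Critical-point sequence lemma.** Let `x : (0,r₀] → ℝ` be a bounded `C¹` function
whose limit as `r → 0⁺` does not exist (its `liminf` is strictly below its `limsup`).
Then there is a strictly decreasing sequence `r_m → 0` of points with `x′(r_m) = 0`
such that `x(r_m)` converges. -/
theorem critical_point_sequence
    (r₀ : ℝ) (hr₀ : 0 < r₀) (x : ℝ → ℝ)
    (hdiff : ∀ r ∈ Ioc (0:ℝ) r₀, DifferentiableAt ℝ x r)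
    (hderiv_cont : ContinuousOn (deriv x) (Ioc 0 r₀))
    (hbdd : ∃ M : ℝ, ∀ r ∈ Ioc (0:ℝ) r₀, |x r| ≤ M)
    (hnolim : Filter.liminf x (𝓝[>] 0) < Filter.limsup x (𝓝[>] 0)) :
    ∃ r : ℕ → ℝ, StrictAnti r ∧ (∀ m, r m ∈ Ioc (0:ℝ) r₀) ∧
      Tendsto r atTop (𝓝 0) ∧ (∀ m, deriv x (r m) = 0) ∧
      ∃ L : ℝ, Tendsto (fun m => x (r m)) atTop (𝓝 L) := by
  obtain ⟨M, hM⟩ := hbdd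
  have hglb : IsGLB {r | r ∈ Ioc (0:ℝ) r₀ ∧ deriv x r = 0} 0 := by
    refine ⟨fun r hr => hr.1.1.le, fun b hb => ?_⟩
    by_contra! hb0
    have hε : 0 < min b r₀ := lt_min hb0 hr₀
    have hsub : Ioo 0 (min b r₀) ⊆ Ioc 0 r₀ :=
      fun r hr => ⟨hr.1, (hr.2.trans_le (min_le_right _ _)).le⟩
    obtain ⟨L, hL⟩ := exists_tendsto_nhdsGT_of_deriv_ne_zero hε
      (fun r hr => hdiff r (hsub hr))
      (fun r hr h0 => (hr.2.trans_le (min_le_left _ _)).not_ge (hb ⟨hsub hr, h0⟩))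
      (fun r hr => hM r (hsub hr))
    rw [hL.liminf_eq, hL.limsup_eq] at hnolim
    exact lt_irrefl _ hnolim
  have hne : {r | r ∈ Ioc (0:ℝ) r₀ ∧ deriv x r = 0}.Nonempty := by
    by_contra! h
    rw [h] at hglb
    exact zero_lt_one.not_ge (hglb.2 (by simp : (1:ℝ) ∈ lowerBounds ∅))
  obtain ⟨u, hu_anti, -, hu_lim, hu⟩ :=
    hglb.exists_seq_strictAnti_tendsto_of_notMem (fun h => lt_irrefl _ h.1.1) hne
  obtain ⟨L, -, φ, hφ, hL⟩ := isCompact_Icc.tendsto_subseq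
    (fun n => abs_le.mp (hM (u n) (hu n).1) : ∀ n, x (u n) ∈ Icc (-M) M)
  exact ⟨u ∘ φ, hu_anti.comp_strictMono hφ, fun m => (hu _).1,
    hu_lim.comp hφ.tendsto_atTop, fun m => (hu _).2, L, hL⟩
end
end

section
/- For every real y > 1 one has y³(2y+1)/(y−1) ≥ (26+15√3)/2, with equality if and only if y = (1+√3)/2. -/
noncomputable section

/-- The difference of the two sides, with the double root at `(1+√3)/2` factored out. -/
theorem cubic_ratio_sub_critical {y : ℝ} (hy : y ≠ 1) :
    y ^ 3 * (2 * y + 1) / (y - 1) - (26 + 15 * Real.sqrt 3) / 2 =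
      (y - (1 + Real.sqrt 3) / 2) ^ 2 *
        ((2 * y ^ 2 + (3 + 2 * Real.sqrt 3) * y + (7 + 4 * Real.sqrt 3)) / (y - 1)) := by
  have hs : Real.sqrt 3 ^ 2 = 3 := Real.sq_sqrt (by norm_num)
  have hy' : y - 1 ≠ 0 := sub_ne_zero.mpr hy
  rw [← mul_div_assoc, eq_div_iff hy', sub_mul, div_mul_cancel₀ _ hy']
  generalize Real.sqrt 3 = s at hs ⊢
  grind

/-- For every real `y > 1` one has `y³(2y+1)/(y−1) ≥ (26+15√3)/2`, with equality
if and only if `y = (1+√3)/2`. -/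
theorem cubic_ratio_ge_critical (y : ℝ) (hy : 1 < y) :
    (26 + 15 * Real.sqrt 3) / 2 ≤ y ^ 3 * (2 * y + 1) / (y - 1) ∧
    (y ^ 3 * (2 * y + 1) / (y - 1) = (26 + 15 * Real.sqrt 3) / 2 ↔
      y = (1 + Real.sqrt 3) / 2) := by
  have hy' : 0 < y - 1 := sub_pos.mpr hy
  have key := cubic_ratio_sub_critical hy.ne'
  have hq : 0 < (2 * y ^ 2 + (3 + 2 * Real.sqrt 3) * y + (7 + 4 * Real.sqrt 3)) / (y - 1) := by
    positivity
  constructor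
  · rw [← sub_nonneg, key]
    positivity
  · rw [← sub_eq_zero, key, mul_eq_zero, or_iff_left hq.ne', sq_eq_zero_iff, sub_eq_zero]
end
end

section
/- Let α > 0 and ξ > 0, and define S(x) := 2x² + √α x^{3/2} − ξ √α x^{1/2} + ξ α for x > 0. Then there exists x > α with S(x) < 0 if and only if ξ/α > (26+15√3)/2. -/
/-- At the critical ratio the quartic has the double root `t = (1 + √3) / 2 * a`. -/
lemma quartic_critical_factorization (a t : ℝ) :
    2 * t ^ 4 + a * t ^ 3 - (26 + 15 * Real.sqrt 3) / 2 * a ^ 3 * (t - a) =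
      (t - (1 + Real.sqrt 3) / 2 * a) ^ 2 *
        (2 * t ^ 2 + (3 + 2 * Real.sqrt 3) * a * t + (7 + 4 * Real.sqrt 3) * a ^ 2) := by
  have h3 : Real.sqrt 3 ^ 2 = 3 := Real.sq_sqrt (by norm_num)
  generalize Real.sqrt 3 = r at h3 ⊢
  linear_combination (3 / 2 * a ^ 2 * t ^ 2 +
    (9 / 4 - r / 2) * a ^ 3 * t - (15 / 4 + r) * a ^ 4) * h3

/-- The rational powers in the quartic form of `S`, in the variable `t = √x`. -/
lemma S_eq_quartic {t : ℝ} (ht : 0 ≤ t) (a ξ : ℝ) :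
    2 * (t ^ 2) ^ 2 + a * (t ^ 2) ^ ((3:ℝ)/2) - ξ * a * (t ^ 2) ^ ((1:ℝ)/2) + ξ * a ^ 2 =
      2 * t ^ 4 + a * t ^ 3 - ξ * a * (t - a) := by
  have h3 : (t ^ 2) ^ ((3:ℝ)/2) = t ^ 3 := by
    rw [← Real.rpow_natCast_mul ht, ← Real.rpow_natCast]
    norm_num
  have h1 : (t ^ 2) ^ ((1:ℝ)/2) = t := by
    rw [← Real.sqrt_eq_rpow, Real.sqrt_sq ht]
  rw [h3, h1]
  ring

/-- Let `α > 0`, `ξ > 0` and `S(x) = 2x² + √α x^{3/2} − ξ √α x^{1/2} + ξα`. Then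
there exists `x > α` with `S(x) < 0` if and only if `ξ/α > (26+15√3)/2`. -/
theorem exists_negative_S_iff_supercritical (α ξ : ℝ) (hα : 0 < α) (hξ : 0 < ξ) :
    (∃ x : ℝ, α < x ∧
        2 * x ^ 2 + Real.sqrt α * x ^ ((3:ℝ)/2) - ξ * Real.sqrt α * x ^ ((1:ℝ)/2)
          + ξ * α < 0) ↔
      ξ / α > (26 + 15 * Real.sqrt 3) / 2 := by
  obtain ⟨a, ha, rfl⟩ : ∃ a : ℝ, 0 < a ∧ a ^ 2 = α :=
    ⟨Real.sqrt α, Real.sqrt_pos.2 hα, Real.sq_sqrt hα.le⟩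
  rw [Real.sqrt_sq ha.le, gt_iff_lt, lt_div_iff₀ hα]
  constructor
  · rintro ⟨x, hx, hS⟩
    obtain ⟨t, ht, rfl⟩ : ∃ t : ℝ, 0 ≤ t ∧ t ^ 2 = x :=
      ⟨Real.sqrt x, Real.sqrt_nonneg x, Real.sq_sqrt (hα.trans hx).le⟩
    have hat : 0 < t - a := sub_pos.2 (lt_of_pow_lt_pow_left₀ 2 ht hx)
    rw [S_eq_quartic ht] at hS
    have hnonneg : 0 ≤ 2 * t ^ 4 + a * t ^ 3 -
        (26 + 15 * Real.sqrt 3) / 2 * a ^ 3 * (t - a) := by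
      rw [quartic_critical_factorization]
      positivity
    refine lt_of_mul_lt_mul_right ?_ (mul_pos ha hat).le
    linarith
  · intro hk
    have h3 : 1 < Real.sqrt 3 := Real.lt_sqrt_of_sq_lt (by norm_num)
    have hat : a < (1 + Real.sqrt 3) / 2 * a := lt_mul_of_one_lt_left ha (by linarith)
    refine ⟨((1 + Real.sqrt 3) / 2 * a) ^ 2, pow_lt_pow_left₀ hat ha.le two_ne_zero, ?_⟩
    rw [S_eq_quartic (ha.trans hat).le]
    have hzero := quartic_critical_factorization a ((1 + Real.sqrt 3) / 2 * a)
    rw [sub_self, zero_pow two_ne_zero, zero_mul] at hzero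
    have := mul_lt_mul_of_pos_right hk (mul_pos ha (sub_pos.2 hat))
    linarith
end

section
/- Let α > 0 and ξ > 0, and define S(x) := 2x² + √α x^{3/2} − ξ √α x^{1/2} + ξ α for x > 0. If there exists l ≥ α with S(l) = 0, then ξ/α ≥ (26+15√3)/2. -/
noncomputable section

/-- The line of slope `(26 + 15√3)/2` through `(1, 0)` is tangent to `u ↦ 2u⁴ + u³`
at `u = (1 + √3)/2` and lies below it on `[0, ∞)`. -/
lemma tangent_line_le_quartic {u : ℝ} (hu : 0 ≤ u) :
    (26 + 15 * Real.sqrt 3) / 2 * (u - 1) ≤ 2 * u ^ 4 + u ^ 3 := by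
  obtain ⟨v, hv⟩ : ∃ v, v = (1 + Real.sqrt 3) / 2 := ⟨_, rfl⟩
  have h3 : Real.sqrt 3 = 2 * v - 1 := by linarith
  have hv0 : 0 ≤ v := by rw [hv]; positivity
  have hv2 : v ^ 2 = v + 1 / 2 := by
    have := Real.sq_sqrt (show (0 : ℝ) ≤ 3 by norm_num)
    rw [h3] at this
    linarith
  have hv3 : v ^ 3 = 3 / 2 * v + 1 / 2 := by linear_combination (v + 1) * hv2
  have hv4 : v ^ 4 = 2 * v + 3 / 4 := by linear_combination v * hv3 + 3 / 2 * hv2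
  have key : 2 * u ^ 4 + u ^ 3 - (26 + 15 * Real.sqrt 3) / 2 * (u - 1)
      = (u - v) ^ 2 * (2 * u ^ 2 + (1 + 4 * v) * u + (2 * v + 6 * v ^ 2)) := by
    rw [h3]
    linear_combination (3 * u) * hv2 + (8 * u - 2) * hv3 - 6 * hv4
  have : 0 ≤ (u - v) ^ 2 * (2 * u ^ 2 + (1 + 4 * v) * u + (2 * v + 6 * v ^ 2)) := by
    positivity
  linarith

/-- Let `α > 0`, `ξ > 0` and `S(x) = 2x² + √α x^{3/2} − ξ √α x^{1/2} + ξα`. If there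
exists `l ≥ α` with `S(l) = 0`, then `ξ/α ≥ (26+15√3)/2`. -/
theorem supercritical_of_root_ge (α ξ l : ℝ) (hα : 0 < α) (hξ : 0 < ξ) (hl : α ≤ l)
    (hroot : 2 * l ^ 2 + Real.sqrt α * l ^ ((3:ℝ)/2) - ξ * Real.sqrt α * l ^ ((1:ℝ)/2)
      + ξ * α = 0) :
    ξ / α ≥ (26 + 15 * Real.sqrt 3) / 2 := by
  have hl0 : 0 < l := hα.trans_le hl
  have hsqrt : l ^ ((1:ℝ)/2) = Real.sqrt l := (Real.sqrt_eq_rpow l).symm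
  have hcube : l ^ ((3:ℝ)/2) = Real.sqrt l ^ 3 := by
    rw [Real.sqrt_eq_rpow, ← Real.rpow_natCast, ← Real.rpow_mul hl0.le]
    norm_num
  have ha : 0 < Real.sqrt α := Real.sqrt_pos.mpr hα
  have ha2 : Real.sqrt α ^ 2 = α := Real.sq_sqrt hα.le
  have ht2 : Real.sqrt l ^ 2 = l := Real.sq_sqrt hl0.le
  have hle : Real.sqrt α ≤ Real.sqrt l := Real.sqrt_le_sqrt hl
  rw [hsqrt, hcube] at hroot
  generalize Real.sqrt α = a at *
  generalize Real.sqrt l = t at *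
  subst ha2 ht2
  obtain ⟨u, rfl⟩ : ∃ u, t = a * u := ⟨t / a, by field_simp⟩
  have hu : 1 ≤ u := by
    by_contra! h
    nlinarith
  obtain ⟨r, rfl⟩ : ∃ r, ξ = r * a ^ 2 := ⟨ξ / a ^ 2, by field_simp⟩
  have hr : r * (u - 1) = 2 * u ^ 4 + u ^ 3 := by
    have : a ^ 4 * (2 * u ^ 4 + u ^ 3 - r * (u - 1)) = 0 := by linear_combination hroot
    have := (mul_eq_zero.mp this).resolve_left (by positivity)
    linarith
  have hu1 : 0 < u - 1 := by
    refine lt_of_le_of_ne (by linarith) fun h => ?_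
    rw [← h, mul_zero] at hr
    have : 0 < 2 * u ^ 4 + u ^ 3 := by positivity
    linarith
  rw [mul_div_cancel_right₀ r hα.ne']
  exact le_of_mul_le_mul_right
    (hr ▸ tangent_line_le_quartic (zero_le_one.trans hu)) hu1
end
end

section
/- Weak energy condition characterization: Let R > 0, Y > 0, and let Ψ_r, Ψ_R, Ψ_rR, Ψ_RR, Y_R be real numbers. For s > 0 define ε(s) := (1/(4πR²))(s Ψ_r/Y + Ψ_R), p_r := −Ψ_R/(4πR²), and p_t(s) := −(s/(8πR))(Ψ_rR/Y − Ψ_r Y_R/Y² + Ψ_RR/s). Then the three inequalities ε(s) ≥ 0, ε(s) + p_r ≥ 0, and ε(s) + p_t(s) ≥ 0 hold for all s > 0 if and only if: Ψ_r ≥ 0, Ψ_R ≥ 0, Ψ_r ≥ (R/2) Y (Ψ_rR/Y − Ψ_r Y_R/Y²), and Ψ_R ≥ (R/2) Ψ_RR. -/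
noncomputable section

open Real

/-- An affine function is nonnegative on the positive reals exactly when both of its coefficients
are nonnegative. -/
theorem forall_pos_mul_add_nonneg_iff (a b : ℝ) :
    (∀ s : ℝ, 0 < s → 0 ≤ s * a + b) ↔ 0 ≤ a ∧ 0 ≤ b := by
  refine ⟨fun h => ⟨?_, ?_⟩, fun ⟨ha, hb⟩ s hs => by positivity⟩
  · by_contra! ha
    have hs : 0 < (|b| + 1) / -a := div_pos (by positivity) (neg_pos.2 ha)
    have hval : (|b| + 1) / -a * a = -(|b| + 1) := by
      field_simp [ha.ne]
    linarith [h _ hs, le_abs_self b]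
  · by_contra! hb
    have hs : 0 < -b / (2 * (|a| + 1)) := div_pos (neg_pos.2 hb) (by positivity)
    have hle : -b / (2 * (|a| + 1)) * a ≤ -b / 2 := by
      calc -b / (2 * (|a| + 1)) * a ≤ -b / (2 * (|a| + 1)) * (|a| + 1) := by
            gcongr
            linarith [le_abs_self a]
        _ = -b / 2 := by field_simp
    linarith [h _ hs]

/-- **Weak energy condition characterization.** With `ε(s) = (1/(4πR²))(sΨ_r/Y + Ψ_R)`,
`p_r = −Ψ_R/(4πR²)` and `p_t(s) = −(s/(8πR))(Ψ_rR/Y − Ψ_r Y_R/Y² + Ψ_RR/s)`, the weak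
energy condition `ε(s) ≥ 0`, `ε(s) + p_r ≥ 0`, `ε(s) + p_t(s) ≥ 0` holds for every
value `s > 0` of the strain `√η` if and only if `Ψ_r ≥ 0`, `Ψ_R ≥ 0`,
`Ψ_r ≥ (R/2) Y (Ψ_rR/Y − Ψ_r Y_R/Y²)` and `Ψ_R ≥ (R/2) Ψ_RR`. -/
theorem weak_energy_condition_iff
    (R Y Ψr ΨR ΨrR ΨRR YR : ℝ) (hR : 0 < R) (hY : 0 < Y) :
    (∀ s : ℝ, 0 < s →
        0 ≤ (1 / (4 * π * R ^ 2)) * (s * Ψr / Y + ΨR) ∧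
        0 ≤ (1 / (4 * π * R ^ 2)) * (s * Ψr / Y + ΨR) + -(ΨR / (4 * π * R ^ 2)) ∧
        0 ≤ (1 / (4 * π * R ^ 2)) * (s * Ψr / Y + ΨR) +
          -((s / (8 * π * R)) * (ΨrR / Y - Ψr * YR / Y ^ 2 + ΨRR / s))) ↔
      (0 ≤ Ψr ∧ 0 ≤ ΨR ∧
        (R / 2) * Y * (ΨrR / Y - Ψr * YR / Y ^ 2) ≤ Ψr ∧
        (R / 2) * ΨRR ≤ ΨR) := by
  have hc : 0 < 1 / (4 * π * R ^ 2) := by positivity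
  have energy_add_radial (s : ℝ) :
      (1 / (4 * π * R ^ 2)) * (s * Ψr / Y + ΨR) + -(ΨR / (4 * π * R ^ 2)) =
        (1 / (4 * π * R ^ 2)) * (s * (Ψr / Y)) := by ring
  have energy_add_tangential (s : ℝ) (hs : 0 < s) :
      (1 / (4 * π * R ^ 2)) * (s * Ψr / Y + ΨR) +
          -((s / (8 * π * R)) * (ΨrR / Y - Ψr * YR / Y ^ 2 + ΨRR / s)) =
        (1 / (4 * π * R ^ 2)) *
          (s * ((Ψr - (R / 2) * Y * (ΨrR / Y - Ψr * YR / Y ^ 2)) / Y) +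
            (ΨR - (R / 2) * ΨRR)) := by
    generalize ΨrR / Y - Ψr * YR / Y ^ 2 = A
    field_simp
    ring
  have energy := forall_pos_mul_add_nonneg_iff (Ψr / Y) ΨR
  have tangential := forall_pos_mul_add_nonneg_iff
    ((Ψr - (R / 2) * Y * (ΨrR / Y - Ψr * YR / Y ^ 2)) / Y) (ΨR - (R / 2) * ΨRR)
  simp only [le_div_iff₀ hY, zero_mul, sub_nonneg] at energy tangential
  constructor
  · intro h
    obtain ⟨hr, hR'⟩ := energy.1 fun s hs => by
      simpa only [mul_div_assoc] using nonneg_of_mul_nonneg_right (h s hs).1 hc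
    obtain ⟨htr, htR⟩ := tangential.1 fun s hs => by
      have ht := (h s hs).2.2
      rw [energy_add_tangential s hs] at ht
      exact nonneg_of_mul_nonneg_right ht hc
    exact ⟨hr, hR', htr, htR⟩
  · rintro ⟨hr, hR', htr, htR⟩ s hs
    rw [energy_add_radial, energy_add_tangential s hs]
    exact ⟨by positivity, by positivity, mul_nonneg hc.le (tangential.2 ⟨htr, htR⟩ s hs)⟩
end
end
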